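/- Let S be a regular local ring with maximal ideal m = (x_1,…,x_c) of embedding dimension c, and let g_1,…,g_c be a maximal regular sequence contained in m^2, with R = S/(g_1,…,g_c). Write g_j = Σ_i a_{ij} x_i and A = (a_{ij}). Then R is a zero-dimensional Gorenstein local ring and the image of det A in R generates the socle of R. -/

import Mathlib

open IsLocalRing RingTheory.Sequence
open scoped Pointwise

theorem exchange_aux {S : Type*} [CommRing S] (J m : Ideal S) (a b d e : S)
    (ham : a ∈ m)
    (ha : ∀ s, a * s ∈ J → s ∈ J) (hb : ∀ s, b * s ∈ J → s ∈ J)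
    (hde : b * d - a * e ∈ J)
    (h1 : d ∉ J ⊔ Ideal.span {a})
    (h2 : ∀ u, (∀ r ∈ m, r * u ∈ J ⊔ Ideal.span {a}) → ∃ s, u - s * d ∈ J ⊔ Ideal.span {a}) :
    e ∉ J ⊔ Ideal.span {b} ∧
    ∀ u, (∀ r ∈ m, r * u ∈ J ⊔ Ideal.span {b}) → ∃ s, u - s * e ∈ J ⊔ Ideal.span {b} := by
  have key : ∀ a u : S, u ∈ J ⊔ Ideal.span {a} ↔ ∃ t, u - t * a ∈ J := by
    intro a u
    rw [Submodule.mem_sup]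
    constructor
    · rintro ⟨y, hy, z, hz, rfl⟩
      obtain ⟨t, rfl⟩ := Ideal.mem_span_singleton'.1 hz
      exact ⟨t, by simpa using hy⟩
    · rintro ⟨t, ht⟩
      exact ⟨_, ht, t * a, Ideal.mem_span_singleton'.2 ⟨t, rfl⟩, by ring⟩
  simp only [key] at *
  constructor
  · rintro ⟨t, ht⟩
    apply h1
    refine ⟨t, hb _ ?_⟩
    have := J.add_mem hde (J.mul_mem_left a ht)
    convert this using 1; ring
  · intro v hv
    obtain ⟨u, hu⟩ := hv a ham
    have hu' : ∀ r ∈ m, ∃ t, r * u - t * a ∈ J := by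
      intro r hr
      obtain ⟨w, hw⟩ := hv r hr
      refine ⟨w, hb _ ?_⟩
      have := J.sub_mem (J.mul_mem_left a hw) (J.mul_mem_left r hu)
      convert this using 1; ring
    obtain ⟨s, t, hst⟩ := h2 u hu'
    refine ⟨s, t, ha _ ?_⟩
    have := J.add_mem (J.add_mem hu (J.mul_mem_left b hst)) (J.mul_mem_left s hde)
    convert this using 1; ring

theorem det_aux {S : Type*} [CommRing S] {c : ℕ} (x f : Fin c → S) (i : Fin c) (b : S)
    (J : Ideal S) (hJ : ∀ j, j ≠ i → f j ∈ J)
    (A : Matrix (Fin c) (Fin c) S) (s : Fin c → S)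
    (hA : ∀ i, f i = ∑ j, A i j * x j) (hs : b = ∑ j, s j * x j)
    (ha : ∀ s, f i * s ∈ J → s ∈ J) :
    b * A.det - f i * (A.updateRow i s).det ∈ J := by
  set B := A.updateRow i (b • A i - f i • s) with hB
  have hdet : B.det = b * A.det - f i * (A.updateRow i s).det := by
    rw [hB, sub_eq_add_neg, Matrix.det_updateRow_add, Matrix.det_updateRow_smul, ← neg_smul,
      Matrix.det_updateRow_smul, Matrix.updateRow_eq_self]
    ring
  have hBx : ∀ j, (B.mulVec x) j ∈ J := by
    intro j
    by_cases h : j = i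
    · subst h
      have : B.mulVec x j = 0 := by
        simp only [Matrix.mulVec, dotProduct, hB, Matrix.updateRow_self, Pi.sub_apply,
          Pi.smul_apply, smul_eq_mul, sub_mul, Finset.sum_sub_distrib, mul_assoc,
          ← Finset.mul_sum]
        rw [← hA, ← hs]; ring
      rw [this]; exact J.zero_mem
    · have : B.mulVec x j = f j := by
        simp only [Matrix.mulVec, dotProduct, hB, Matrix.updateRow_ne h, hA]
      rw [this]; exact hJ j h
  have hD : ∀ k, B.det * x k ∈ J := by
    intro k
    have : B.det * x k = (B.adjugate.mulVec (B.mulVec x)) k := by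
      rw [Matrix.mulVec_mulVec, Matrix.adjugate_mul, Matrix.smul_mulVec, Matrix.one_mulVec]; simp
    rw [this]
    simp only [Matrix.mulVec, dotProduct] at hBx ⊢
    exact J.sum_mem fun j _ => J.mul_mem_left _ (hBx j)
  rw [← hdet]
  apply ha
  rw [hA i, Finset.sum_mul]
  refine J.sum_mem fun j _ => ?_
  have := J.mul_mem_left (A i j) (hD j)
  convert this using 1; ring

theorem avoid_aux {S : Type*} [CommRing S] [IsNoetherianRing S] (m I I' : Ideal S) (a a' : S)
    (ham : a ∈ m) (ham' : a' ∈ m)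
    (ha : ∀ s, a * s ∈ I → s ∈ I) (ha' : ∀ s, a' * s ∈ I' → s ∈ I') :
    ∃ h ∈ m, (∀ s, h * s ∈ I → s ∈ I) ∧ (∀ s, h * s ∈ I' → s ∈ I') := by
  by_contra! hcon
  have hsub : (m : Set S) ⊆ ⋃ p ∈ associatedPrimes S ((S ⧸ I) × (S ⧸ I')), (p : Set S) := by
    rw [biUnion_associatedPrimes_eq_zero_divisors]
    intro h hh
    by_cases h1 : ∀ s, h * s ∈ I → s ∈ I
    · obtain ⟨s, hs, hs'⟩ := hcon h hh h1
      refine ⟨(0, Ideal.Quotient.mk I' s), ?_, ?_⟩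
      · simpa [Prod.ext_iff, Ideal.Quotient.eq_zero_iff_mem] using hs'
      · ext
        · simp
        · change Ideal.Quotient.mk I' (h * s) = 0
          rwa [Ideal.Quotient.eq_zero_iff_mem]
    · push Not at h1
      obtain ⟨s, hs, hs'⟩ := h1
      refine ⟨(Ideal.Quotient.mk I s, 0), ?_, ?_⟩
      · simpa [Prod.ext_iff, Ideal.Quotient.eq_zero_iff_mem] using hs'
      · ext
        · change Ideal.Quotient.mk I (h * s) = 0
          rwa [Ideal.Quotient.eq_zero_iff_mem]
        · simp
  obtain ⟨p, hp, hmp⟩ := (m.subset_union_prime_finite (associatedPrimes.finite S _)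
    (f := id) 0 0 fun _ h _ _ ↦ h.isPrime).1 hsub
  obtain ⟨hpp, ⟨z1, z2⟩, hz⟩ := isAssociatedPrime_iff.1 (AssociatedPrimes.mem_iff.1 hp)
  obtain ⟨z1, rfl⟩ := Ideal.Quotient.mk_surjective z1
  obtain ⟨z2, rfl⟩ := Ideal.Quotient.mk_surjective z2
  have hz' : ∀ r, r ∈ p ↔ r * z1 ∈ I ∧ r * z2 ∈ I' := by
    intro r
    rw [hz, Submodule.mem_colon_singleton, Submodule.mem_bot, Prod.ext_iff]
    simp only [Prod.smul_mk, Prod.fst_zero, Prod.snd_zero]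
    rw [← Ideal.Quotient.eq_zero_iff_mem, ← Ideal.Quotient.eq_zero_iff_mem]
    rfl
  have h1 := ha _ ((hz' a).1 (hmp ham)).1
  have h2 := ha' _ ((hz' a').1 (hmp ham')).2
  exact hpp.ne_top ((Ideal.eq_top_iff_one _).2 ((hz' 1).2 (by simp [h1, h2])))

theorem reg_iff {S : Type*} [CommRing S] [IsNoetherianRing S] [IsLocalRing S] {c : ℕ}
    (f : Fin c → S) (hf : ∀ j, f j ∈ maximalIdeal S) (i : Fin c) :
    IsWeaklyRegular S (List.ofFn f) ↔
      IsWeaklyRegular S (((List.finRange c).erase i).map f) ∧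
      ∀ s, f i * s ∈ Ideal.span (f '' {j | j ≠ i}) → s ∈ Ideal.span (f '' {j | j ≠ i}) := by
  have hperm : (List.ofFn f).Perm ((((List.finRange c).erase i).map f) ++ [f i]) := by
    rw [List.ofFn_eq_map]
    have h1 := (List.perm_cons_erase (List.mem_finRange i)).map f
    refine h1.trans ?_
    rw [List.map_cons]
    exact (List.perm_append_singleton _ _).symm
  have h1 : IsWeaklyRegular S (List.ofFn f) ↔
      IsWeaklyRegular S ((((List.finRange c).erase i).map f) ++ [f i]) := by
    constructor
    · intro h
      refine isWeaklyRegular_of_perm_of_subset_maximalIdeal h hperm ?_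
      intro r hr
      obtain ⟨j, rfl⟩ := (List.mem_ofFn' _ _).1 hr
      exact hf j
    · intro h
      refine isWeaklyRegular_of_perm_of_subset_maximalIdeal h hperm.symm ?_
      intro r hr
      obtain ⟨j, rfl⟩ := (List.mem_ofFn' _ _).1 (hperm.symm.mem_iff.1 hr)
      exact hf j
  have h2 : (Ideal.ofList (((List.finRange c).erase i).map f) • ⊤ : Submodule S S)
      = Ideal.span (f '' {j | j ≠ i}) := by
    rw [smul_eq_mul, Ideal.mul_top, Ideal.ofList]
    congr 1
    ext r
    simp [(List.nodup_finRange c).mem_erase_iff]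
  rw [h1, isWeaklyRegular_append_iff, isWeaklyRegular_singleton_iff, h2]
  refine and_congr_right fun _ => ?_
  rw [isSMulRegular_iff_right_eq_zero_of_smul]
  constructor
  · intro h s hs
    have := h (Ideal.Quotient.mk _ s) (by
      change Ideal.Quotient.mk _ (f i * s) = 0
      rwa [Ideal.Quotient.eq_zero_iff_mem])
    rwa [Ideal.Quotient.eq_zero_iff_mem] at this
  · intro h s hs
    obtain ⟨s, rfl⟩ := Ideal.Quotient.mk_surjective s
    change Ideal.Quotient.mk _ (f i * s) = 0 at hs
    rw [Ideal.Quotient.eq_zero_iff_mem] at hs ⊢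
    exact h _ hs

/-- the socle property -/
def SocProp {S : Type*} [CommRing S] {c : ℕ} (m : Ideal S) (x f : Fin c → S) : Prop :=
  ∀ A : Matrix (Fin c) (Fin c) S, (∀ i, f i = ∑ j, A i j * x j) →
    A.det ∉ Ideal.span (Set.range f) ∧
    ∀ u, (∀ r ∈ m, r * u ∈ Ideal.span (Set.range f)) →
      ∃ s, u - s * A.det ∈ Ideal.span (Set.range f)

theorem span_split {S : Type*} [CommRing S] {c : ℕ} (f : Fin c → S) (i : Fin c) :
    Ideal.span (Set.range f) = Ideal.span (f '' {j | j ≠ i}) ⊔ Ideal.span {f i} := by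
  rw [← Ideal.span_union, ← Set.image_singleton, ← Set.image_union, ← Set.image_univ]
  congr 2
  ext j
  simp [em]

theorem update_image {S : Type*} {c : ℕ} (f : Fin c → S) (i : Fin c) (b : S) :
    Function.update f i b '' {j | j ≠ i} = f '' {j | j ≠ i} := by
  apply Set.image_congr
  intro j hj
  exact Function.update_of_ne hj _ _

theorem SocProp.step {S : Type*} [CommRing S] {c : ℕ} {m : Ideal S} {x f : Fin c → S}
    (hm : m = Ideal.span (Set.range x)) (hP : SocProp m x f) (i : Fin c) (b : S)
    (hfm : f i ∈ m) 
    (ha : ∀ s, f i * s ∈ Ideal.span (f '' {j | j ≠ i}) → s ∈ Ideal.span (f '' {j | j ≠ i}))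
    (hb : ∀ s, b * s ∈ Ideal.span (f '' {j | j ≠ i}) → s ∈ Ideal.span (f '' {j | j ≠ i})) :
    SocProp m x (Function.update f i b) := by
  intro A hA
  have hx := hfm
  rw [hm, Ideal.mem_span_range_iff_exists_fun] at hx
  obtain ⟨s, hs⟩ := hx
  have hA' : ∀ k, f k = ∑ j, (A.updateRow i s) k j * x j := by
    intro k
    by_cases h : k = i
    · subst h; simp [hs]
    · have := hA k
      rw [Function.update_of_ne h] at this
      simp only [Matrix.updateRow_ne h, this]
  obtain ⟨h1, h2⟩ := hP _ hA'
  rw [span_split f i] at h1 h2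
  rw [span_split _ i, update_image, Function.update_self]
  refine exchange_aux _ m (f i) b _ _ hfm ha hb ?_ h1 h2
  have := det_aux x f i b (Ideal.span (f '' {j | j ≠ i}))
    (fun j hj => Ideal.subset_span ⟨j, hj, rfl⟩) (A.updateRow i s) (A i) hA'
    (by simpa using hA i) ha
  simpa using this

theorem SocProp.chain {S : Type*} [CommRing S] [IsNoetherianRing S] [IsLocalRing S] {c : ℕ}
    (x : Fin c → S) (hm : maximalIdeal S = Ideal.span (Set.range x)) (n : ℕ) :
    ∀ (f f' : Fin c → S) (T : Finset (Fin c)), Tᶜ.card = n →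
    (∀ i ∈ T, f i = f' i) →
    (∀ i, f i ∈ maximalIdeal S) → (∀ i, f' i ∈ maximalIdeal S) →
    IsWeaklyRegular S (List.ofFn f) → IsWeaklyRegular S (List.ofFn f') →
    SocProp (maximalIdeal S) x f → SocProp (maximalIdeal S) x f' := by
  induction n with
  | zero =>
    intro f f' T hT heq _ _ _ _ h
    have : f = f' := by
      funext i
      apply heq
      simp at hT
      simp [hT]
    rwa [← this]
  | succ n ih =>
    intro f f' T hT heq hf hf' hr hr' h
    obtain ⟨i, hi⟩ : Tᶜ.Nonempty := by rw [← Finset.card_pos]; omega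
    obtain ⟨r1, r2⟩ := (reg_iff f hf i).1 hr
    obtain ⟨r1', r2'⟩ := (reg_iff f' hf' i).1 hr'
    obtain ⟨b, hbm, hb, hb'⟩ := avoid_aux (maximalIdeal S) _ _ _ _ (hf i) (hf' i) r2 r2'
    have hup : ∀ f : Fin c → S, (∀ i, f i ∈ maximalIdeal S) →
        ∀ j, Function.update f i b j ∈ maximalIdeal S := by
      intro f hf j
      by_cases hj : j = i
      · subst hj; simpa using hbm
      · rw [Function.update_of_ne hj]; exact hf j
    have hreg : ∀ f : Fin c → S, (∀ i, f i ∈ maximalIdeal S) →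
        IsWeaklyRegular S (((List.finRange c).erase i).map f) →
        (∀ s, b * s ∈ Ideal.span (f '' {j | j ≠ i}) → s ∈ Ideal.span (f '' {j | j ≠ i})) →
        IsWeaklyRegular S (List.ofFn (Function.update f i b)) := by
      intro f hf h1 h2
      rw [reg_iff _ (hup f hf) i, update_image, Function.update_self]
      refine ⟨?_, h2⟩
      convert h1 using 1
      apply List.map_congr_left
      intro j hj
      exact Function.update_of_ne ((List.nodup_finRange c).mem_erase_iff.1 hj).1 _ _
    have s1 := h.step hm i b (hf i) r2 hb
    have s2 := ih (Function.update f i b) (Function.update f' i b) (insert i T) (by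
        rw [Finset.compl_insert, Finset.card_erase_of_mem hi, hT]; rfl) (by
        intro j hj
        by_cases hji : j = i
        · subst hji; simp
        · rw [Function.update_of_ne hji, Function.update_of_ne hji]
          exact heq j ((Finset.mem_insert.1 hj).resolve_left hji))
        (hup f hf) (hup f' hf') (hreg f hf r1 hb) (hreg f' hf' r1' hb') s1
    have s3 := s2.step hm i (f' i) (by simpa using hbm)
      (by rw [update_image, Function.update_self]; exact hb')
      (by rw [update_image]; exact r2')
    simpa using s3

theorem SocProp.base {S : Type*} [CommRing S] [IsNoetherianRing S] [IsLocalRing S] {c : ℕ}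
    (x : Fin c → S) (hm : maximalIdeal S = Ideal.span (Set.range x))
    (hr : IsWeaklyRegular S (List.ofFn x)) :
    SocProp (maximalIdeal S) x x := by
  have hx : ∀ i, x i ∈ maximalIdeal S := fun i => hm ▸ Ideal.subset_span ⟨i, rfl⟩
  intro A hA
  have hdet : IsUnit A.det := by
    have h1 : A.map (residue S) = 1 := by
      ext i j
      have h2 := ((reg_iff x hx j).1 hr).2 (A i j - (1 : Matrix _ _ S) i j) (by
        have h0 : ∑ k, (A i k - (1 : Matrix _ _ S) i k) * x k = 0 := by
          simp [sub_mul, Finset.sum_sub_distrib, ← hA, Matrix.one_apply]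
        rw [← Finset.add_sum_erase _ _ (Finset.mem_univ j)] at h0
        rw [mul_comm, eq_neg_of_add_eq_zero_left h0]
        refine Ideal.neg_mem_iff _ |>.2 (Ideal.sum_mem _ fun k hk => Ideal.mul_mem_left _ _ ?_)
        exact Ideal.subset_span ⟨k, (Finset.mem_erase.1 hk).1, rfl⟩)
      have h3 : A i j - (1 : Matrix _ _ S) i j ∈ maximalIdeal S := by
        rw [hm, span_split x j]; exact Ideal.mem_sup_left h2
      rw [← residue_eq_zero_iff, map_sub, sub_eq_zero] at h3
      rw [Matrix.map_apply, h3, Matrix.one_apply, Matrix.one_apply]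
      split <;> simp
    have h2 : residue S A.det = 1 := by
      rw [RingHom.map_det, RingHom.mapMatrix_apply, h1, Matrix.det_one]
    by_contra h
    rw [← mem_nonunits_iff, ← mem_maximalIdeal, ← residue_eq_zero_iff, h2] at h
    exact one_ne_zero h
  rw [← hm]
  refine ⟨fun h => h hdet, fun u _ => ?_⟩
  obtain ⟨v, hv⟩ := hdet.exists_left_inv
  exact ⟨u * v, by simp [mul_assoc, hv]⟩

theorem quot_gen {S : Type*} [CommRing S] [IsLocalRing S] {n : ℕ} (y : S)
    [IsLocalRing (S ⧸ Ideal.span {y})] (z : Fin n → S)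
    (h : maximalIdeal S = Ideal.span {y} ⊔ Ideal.span (Set.range z)) :
    maximalIdeal (S ⧸ Ideal.span {y}) =
      Ideal.span (Set.range fun i => Ideal.Quotient.mk (Ideal.span {y}) (z i)) := by
  have hs : Function.Surjective (Ideal.Quotient.mk (Ideal.span {y})) :=
    Ideal.Quotient.mk_surjective
  have : IsLocalHom (Ideal.Quotient.mk (Ideal.span {y})) := hs.isLocalHom _
  have h1 : maximalIdeal (S ⧸ Ideal.span {y}) =
      (maximalIdeal S).map (Ideal.Quotient.mk (Ideal.span {y})) := by
    rw [← show (maximalIdeal (S ⧸ Ideal.span {y})).comap (Ideal.Quotient.mk (Ideal.span {y})) =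
      maximalIdeal S from
      ((local_hom_TFAE (Ideal.Quotient.mk (Ideal.span {y}))).out 0 4).1 this,
      Ideal.map_comap_of_surjective _ hs]
  rw [h1, h, Ideal.map_sup, Ideal.map_quotient_self, bot_sup_eq, Ideal.map_span, ← Set.range_comp]
  rfl

theorem quot_dim {S : Type*} [CommRing S] [IsLocalRing S] [IsNoetherianRing S] {n : ℕ} (y : S)
    (hy : y ∈ maximalIdeal S) (h : ((n + 1 : ℕ) : WithBot ℕ∞) ≤ ringKrullDim S) :
    (n : WithBot ℕ∞) ≤ ringKrullDim (S ⧸ Ideal.span {y}) := by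
  have h1 := ringKrullDim_le_ringKrullDim_quotSMulTop_succ hy
  have h2 : Ideal.span {y} = y • (⊤ : Ideal S) := by simp [← Submodule.ideal_span_singleton_smul]
  rw [← h2] at h1
  have h3 := h.trans h1
  push_cast at h3
  generalize ringKrullDim (S ⧸ Ideal.span {y}) = d at h3
  induction d with
  | bot => exact absurd (le_bot_iff.1 h3) (by exact WithBot.coe_ne_bot (a := ((n:ℕ∞) + 1)))
  | coe d =>
    have h4 : (n : ℕ∞) + 1 ≤ d + 1 := by exact_mod_cast h3
    have : (n : ℕ∞) ≤ d := by
      simpa using h4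
    exact_mod_cast this

theorem reg_domain (n : ℕ) : ∀ (S : Type*) [CommRing S] [IsNoetherianRing S] [IsLocalRing S]
    (x : Fin n → S), maximalIdeal S = Ideal.span (Set.range x) →
    (n : WithBot ℕ∞) ≤ ringKrullDim S → IsDomain S := by
  induction n with
  | zero =>
    intro S _ _ _ x hm _
    have : IsField S := by
      rw [isField_iff_maximalIdeal_eq, hm]; simp
    exact this.isDomain
  | succ n ih =>
    intro S _ _ _ x hm hd
    have hnf : ¬ maximalIdeal S ∈ minimalPrimes S := by
      intro h
      have h1 : ringKrullDim S = 0 := by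
        have := h
        have h2 : Ring.KrullDimLE 0 S := by
          apply Ring.KrullDimLE.mk₀
          intro I hI
          have hle := IsLocalRing.le_maximalIdeal hI.ne_top
          have : I = maximalIdeal S := le_antisymm hle (h.2 ⟨hI, bot_le⟩ hle)
          rw [this]; infer_instance
        exact ringKrullDimZero_iff_ringKrullDim_eq_zero.1 h2
      rw [h1] at hd
      have : n + 1 ≤ 0 := by exact_mod_cast hd
      omega
    have hsq : ¬ maximalIdeal S ≤ maximalIdeal S ^ 2 := by
      intro h
      have h0 : maximalIdeal S = ⊥ := by
        apply Submodule.eq_bot_of_le_smul_of_le_jacobson_bot (maximalIdeal S) _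
          (IsNoetherian.noetherian _)
        · rwa [smul_eq_mul, ← sq]
        · exact maximalIdeal_le_jacobson _
      apply hnf
      refine ⟨⟨inferInstance, bot_le⟩, fun q _ _ => ?_⟩
      rw [h0]; exact bot_le
    obtain ⟨y, hym, hy2, hymin⟩ : ∃ y ∈ maximalIdeal S, y ∉ maximalIdeal S ^ 2 ∧
        ∀ p ∈ minimalPrimes S, y ∉ p := by
      by_contra! hcon
      obtain ⟨p, hp, hmp⟩ := ((maximalIdeal S).subset_union_prime_finite
        (s := insert (maximalIdeal S ^ 2) (minimalPrimes S))
        ((minimalPrimes.finite_of_isNoetherianRing S).insert _)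
        (f := id) (maximalIdeal S ^ 2) (maximalIdeal S ^ 2)
        (fun q hq h _ => ((Set.mem_insert_iff.1 hq).resolve_left h).1.1)).1 (by
          intro y hy
          by_cases h : y ∈ maximalIdeal S ^ 2
          · exact Set.mem_biUnion (Set.mem_insert _ _) h
          · obtain ⟨p, hp, hyp⟩ := hcon y hy h
            exact Set.mem_biUnion (Set.mem_insert_of_mem _ hp) hyp)
      rcases Set.mem_insert_iff.1 hp with rfl | hp
      · exact hsq hmp
      · have : p = maximalIdeal S := le_antisymm (le_maximalIdeal hp.1.1.ne_top) hmp
        exact hnf (this ▸ hp)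
    have hyx := hym
    rw [hm, Ideal.mem_span_range_iff_exists_fun] at hyx
    obtain ⟨a, ha⟩ := hyx
    have hx : ∀ i, x i ∈ maximalIdeal S := fun i => hm ▸ Ideal.subset_span ⟨i, rfl⟩
    obtain ⟨i, hi⟩ : ∃ i, IsUnit (a i) := by
      by_contra! h
      apply hy2
      rw [← ha, sq]
      exact Ideal.sum_mem _ fun i _ => Ideal.mul_mem_mul (h i) (hx i)
    have hgen : maximalIdeal S =
        Ideal.span {y} ⊔ Ideal.span (Set.range fun j => x (i.succAbove j)) := by
      apply le_antisymm
      · rw [hm, Ideal.span_le]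
        rintro _ ⟨k, rfl⟩
        have hz : ∀ j, x (i.succAbove j) ∈
            Ideal.span {y} ⊔ Ideal.span (Set.range fun j => x (i.succAbove j)) :=
          fun j => Ideal.mem_sup_right (Ideal.subset_span ⟨j, rfl⟩)
        rcases Fin.eq_self_or_eq_succAbove i k with rfl | ⟨j, rfl⟩
        · rw [Fin.sum_univ_succAbove _ k] at ha
          rw [SetLike.mem_coe, ← Ideal.unit_mul_mem_iff_mem _ hi, eq_sub_of_add_eq ha]
          exact Ideal.sub_mem _ (Ideal.mem_sup_left (Ideal.mem_span_singleton_self _))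
            (Ideal.sum_mem _ fun j _ => Ideal.mul_mem_left _ _ (hz j))
        · exact hz j
      · rw [sup_le_iff, Ideal.span_le, Ideal.span_le]
        constructor
        · simpa using hym
        · rintro _ ⟨j, rfl⟩; exact hx _
    have hne : Ideal.span {y} ≠ ⊤ := by
      rw [Ne, Ideal.span_singleton_eq_top]; exact hym
    have : Nontrivial (S ⧸ Ideal.span {y}) := Ideal.Quotient.nontrivial_iff.2 hne
    have : IsLocalRing (S ⧸ Ideal.span {y}) :=
      IsLocalRing.of_surjective' _ Ideal.Quotient.mk_surjective
    have hdom := ih (S ⧸ Ideal.span {y}) _ (quot_gen y _ hgen) (quot_dim y hym hd)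
    have hprime : (Ideal.span {y}).IsPrime := (Ideal.Quotient.isDomain_iff_prime _).1 hdom
    obtain ⟨p, hp, hpy⟩ := Ideal.exists_minimalPrimes_le (I := (⊥ : Ideal S))
      (J := Ideal.span {y}) bot_le
    have hpp : p.IsPrime := hp.1.1
    have hp0 : p = ⊥ := by
      apply Submodule.eq_bot_of_le_smul_of_le_jacobson_bot (Ideal.span {y}) _
          (IsNoetherian.noetherian _)
      · intro z hz
        obtain ⟨t, rfl⟩ := Ideal.mem_span_singleton'.1 (hpy hz)
        have ht := (hpp.mem_or_mem hz).resolve_right (hymin p hp)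
        rw [mul_comm]
        exact Ideal.mul_mem_mul (Ideal.mem_span_singleton_self _) ht
      · exact (le_maximalIdeal hne).trans (maximalIdeal_le_jacobson _)
    rw [hp0] at hpp
    exact IsDomain.of_bot_isPrime S

theorem reg_seq (n : ℕ) : ∀ (S : Type*) [CommRing S] [IsNoetherianRing S] [IsLocalRing S]
    (x : Fin n → S), maximalIdeal S = Ideal.span (Set.range x) →
    (n : WithBot ℕ∞) ≤ ringKrullDim S → IsWeaklyRegular S (List.ofFn x) := by
  induction n with
  | zero => intro S _ _ _ x _ _; simp
  | succ n ih =>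
    intro S _ _ _ x hm hd
    have := reg_domain _ S x hm hd
    have hx : ∀ i, x i ∈ maximalIdeal S := fun i => hm ▸ Ideal.subset_span ⟨i, rfl⟩
    have hgen : maximalIdeal S =
        Ideal.span {x 0} ⊔ Ideal.span (Set.range fun j : Fin n => x j.succ) := by
      rw [hm, ← Ideal.span_union]
      congr 1
      ext z
      simp [Fin.exists_fin_succ, eq_comm]
    have h0 : x 0 ≠ 0 := by
      intro h0
      rw [h0, Ideal.span_singleton_zero, bot_sup_eq] at hgen
      have h1 : (maximalIdeal S).spanFinrank ≤ n := by
        rw [hgen]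
        refine (Submodule.spanFinrank_span_le_ncard_of_finite (Set.finite_range _)).trans ?_
        rw [← Set.image_univ]
        refine (Set.ncard_image_le Set.finite_univ).trans ?_
        simp
      have h2 := ringKrullDim_le_spanFinrank_maximalIdeal S
      have h3 := hd.trans (h2.trans (by exact_mod_cast h1 : _ ≤ (n : WithBot ℕ∞)))
      have : n + 1 ≤ n := by exact_mod_cast h3
      omega
    have hne : Ideal.span {x 0} ≠ ⊤ := by
      rw [Ne, Ideal.span_singleton_eq_top]; exact hx 0
    have : Nontrivial (S ⧸ Ideal.span {x 0}) := Ideal.Quotient.nontrivial_iff.2 hne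
    have : IsLocalRing (S ⧸ Ideal.span {x 0}) :=
      IsLocalRing.of_surjective' _ Ideal.Quotient.mk_surjective
    have hr := ih (S ⧸ Ideal.span {x 0}) _ (quot_gen (x 0) _ hgen) (quot_dim (x 0) (hx 0) hd)
    rw [List.ofFn_succ, isWeaklyRegular_cons_iff]
    refine ⟨?_, ?_⟩
    · rw [isSMulRegular_iff_right_eq_zero_of_smul]
      intro s hs
      exact (mul_eq_zero.1 hs).resolve_left h0
    · have h2 : Ideal.span {x 0} = x 0 • (⊤ : Ideal S) := by
        simp [← Submodule.ideal_span_singleton_smul]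
      have e : (S ⧸ Ideal.span {x 0}) ≃ₗ[S] QuotSMulTop (x 0) S := Submodule.quotEquivOfEq _ _ h2
      rw [← e.isWeaklyRegular_congr, ← isWeaklyRegular_map_algebraMap_iff (S ⧸ Ideal.span {x 0}),
        List.map_ofFn]
      exact hr

theorem det_A_generates_socle
    (S : Type*) [CommRing S] [IsNoetherianRing S] [IsLocalRing S]
    (c : ℕ) (x : Fin c → S)
    -- `S` is regular local of dimension `c`, with `m = (x 1, …, x c)`
    (hm : IsLocalRing.maximalIdeal S = Ideal.span (Set.range x))
    (hdim : ringKrullDim S = c)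
    (g : Fin c → S)
    (hg2 : ∀ j, g j ∈ (IsLocalRing.maximalIdeal S) ^ 2)
    (hreg : RingTheory.Sequence.IsRegular S (List.ofFn g))
    (A : Matrix (Fin c) (Fin c) S)
    (hA : ∀ j, g j = ∑ i, A i j * x i) :
    -- `R = S/(g)` is local (as nonzero quotient of a local ring), zero-dimensional, ...
    IsLocalRing (S ⧸ Ideal.span (Set.range g)) ∧
    ringKrullDim (S ⧸ Ideal.span (Set.range g)) = 0 ∧
    -- ... and Gorenstein: the image of `det A` is a nonzero element generating the socle
    (Ideal.Quotient.mk (Ideal.span (Set.range g)) A.det ≠ 0) ∧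
    (∀ y : S ⧸ Ideal.span (Set.range g),
      ((∀ r ∈ IsLocalRing.maximalIdeal S,
          Ideal.Quotient.mk (Ideal.span (Set.range g)) r * y = 0)
        ↔ ∃ q : S ⧸ Ideal.span (Set.range g),
            y = q * Ideal.Quotient.mk (Ideal.span (Set.range g)) A.det)) := by
  have hx : ∀ i, x i ∈ maximalIdeal S := fun i => hm ▸ Ideal.subset_span ⟨i, rfl⟩
  have hg : ∀ i, g i ∈ maximalIdeal S := fun i => Ideal.pow_le_self two_ne_zero (hg2 i)
  have hxr := reg_seq c S x hm hdim.ge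
  have hP := SocProp.chain x hm _ x g ∅ rfl (by simp) hx hg hxr hreg.1
    (SocProp.base x hm hxr)
  have hA' : ∀ i, g i = ∑ j, A.transpose i j * x j := hA
  obtain ⟨h1, h2⟩ := hP A.transpose hA'
  rw [Matrix.det_transpose] at h1 h2
  have hle : Ideal.span (Set.range g) ≤ maximalIdeal S := by
    rw [Ideal.span_le]; rintro _ ⟨i, rfl⟩; exact hg i
  have hne : Ideal.span (Set.range g) ≠ ⊤ := fun h =>
    (maximalIdeal.isMaximal S).ne_top (top_le_iff.1 (h ▸ hle))
  have : Nontrivial (S ⧸ Ideal.span (Set.range g)) := Ideal.Quotient.nontrivial_iff.2 hne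
  have hloc : IsLocalRing (S ⧸ Ideal.span (Set.range g)) :=
    IsLocalRing.of_surjective' _ Ideal.Quotient.mk_surjective
  refine ⟨hloc, ?_, ?_, ?_⟩
  · have h := ringKrullDim_add_length_eq_ringKrullDim_of_isRegular _ hreg
    have he : Ideal.ofList (List.ofFn g) = Ideal.span (Set.range g) := by
      rw [Ideal.ofList]; congr 1; ext; simp
    rw [he, hdim, List.length_ofFn] at h
    have h0 : (0 : WithBot ℕ∞) ≤ ringKrullDim (S ⧸ Ideal.span (Set.range g)) :=
      ringKrullDim_nonneg_of_nontrivial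
    generalize ringKrullDim (S ⧸ Ideal.span (Set.range g)) = d at h h0
    induction d with
    | bot => simp at h0
    | coe d =>
      have h3 : d + (c : ℕ∞) = 0 + c := by rw [zero_add]; exact_mod_cast h
      have h4 : d = 0 := (ENat.add_left_injective_of_ne_top (ENat.natCast_ne_top c)) h3
      rw [h4]; rfl
  · rwa [Ne, Ideal.Quotient.eq_zero_iff_mem]
  · intro y
    obtain ⟨y, rfl⟩ := Ideal.Quotient.mk_surjective y
    constructor
    · intro h
      obtain ⟨s, hs⟩ := h2 y (fun r hr => by
        have := h r hr
        rwa [← map_mul, Ideal.Quotient.eq_zero_iff_mem] at this)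
      refine ⟨Ideal.Quotient.mk _ s, ?_⟩
      rwa [← map_mul, Ideal.Quotient.mk_eq_mk_iff_sub_mem]
    · rintro ⟨q, hq⟩ r hr
      have hk : ∀ r ∈ maximalIdeal S, r * A.det ∈ Ideal.span (Set.range g) := by
        intro r hr
        rw [hm, Ideal.mem_span_range_iff_exists_fun] at hr
        obtain ⟨a, rfl⟩ := hr
        rw [Finset.sum_mul]
        refine Ideal.sum_mem _ fun k _ => ?_
        rw [mul_assoc]
        refine Ideal.mul_mem_left _ _ ?_
        have : x k * A.det = (A.transpose.adjugate.mulVec (A.transpose.mulVec x)) k := by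
          rw [Matrix.mulVec_mulVec, Matrix.adjugate_mul, Matrix.smul_mulVec, Matrix.one_mulVec,
            Matrix.det_transpose]
          simp [mul_comm]
        rw [this, show A.transpose.mulVec x = g from funext fun i => (hA' i).symm]
        simp only [Matrix.mulVec, dotProduct]
        exact Ideal.sum_mem _ fun j _ => Ideal.mul_mem_left _ _ (Ideal.subset_span ⟨j, rfl⟩)
      rw [hq, mul_left_comm, ← map_mul, (Ideal.Quotient.eq_zero_iff_mem).2 (hk r hr), mul_zero]
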